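/- arXiv:1801.06542 — 4 statements merged into one kernel-verified Lean document; each statement's English description precedes it below -/
import Mathlib

section
/- Let n = 2k be an even positive integer and let F, F'' : F_2^n → F_2^n be CCZ-equivalent, i.e., there exists an affine bijection L of F_2^n × F_2^n such that L maps the graph {(x, F(x)) : x ∈ F_2^n} onto the graph {(x, F''(x)) : x ∈ F_2^n}. Then the number of nonzero v ∈ F_2^n for which the component function x ↦ v·F(x) is bent equals 2^n − 2^k if and only if the number of nonzero v ∈ F_2^n for which x ↦ v·F''(x) is bent equals 2^n − 2^k. -/
open Finset

/-- The dot product on `F_2^n`. -/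
def dotp {n : ℕ} (v x : Fin n → ZMod 2) : ZMod 2 := ∑ i, v i * x i

/-- The Walsh transform of a Boolean function `f : F_2^n → F_2` at `u`. -/
def walsh {n : ℕ} (f : (Fin n → ZMod 2) → ZMod 2) (u : Fin n → ZMod 2) : ℤ :=
  ∑ x : Fin n → ZMod 2, (-1 : ℤ) ^ (f x + dotp u x).val

/-- A Boolean function on `F_2^n` is bent if all its Walsh values square to `2^n`. -/
def IsBent {n : ℕ} (f : (Fin n → ZMod 2) → ZMod 2) : Prop :=
  ∀ u : Fin n → ZMod 2, (walsh f u) ^ 2 = 2 ^ n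

/-- The additive character `a ↦ (-1) ^ a` of `F_2`. -/
def signChar (a : ZMod 2) : ℤ := (-1 : ℤ) ^ a.val

theorem signChar_add (a b : ZMod 2) : signChar (a + b) = signChar a * signChar b := by
  revert a b; decide

theorem signChar_sq (a : ZMod 2) : signChar a ^ 2 = 1 := by
  revert a; decide

theorem eq_zero_or_eq_one (a : ZMod 2) : a = 0 ∨ a = 1 := by
  revert a; decide

theorem signChar_zero : signChar 0 = 1 := rfl

theorem signChar_of_ne_zero {a : ZMod 2} (h : a ≠ 0) : signChar a = -1 := by
  revert a; decide

/-- The standard bilinear pairing on `F_2^n × F_2^n`. -/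
def pairing {n : ℕ} (w z : (Fin n → ZMod 2) × (Fin n → ZMod 2)) : ZMod 2 :=
  w.1 ⬝ᵥ z.1 + w.2 ⬝ᵥ z.2

theorem pairing_add_right {n : ℕ} (w y z : (Fin n → ZMod 2) × (Fin n → ZMod 2)) :
    pairing w (y + z) = pairing w y + pairing w z := by
  simp only [pairing, Prod.fst_add, Prod.snd_add, dotProduct_add]; ring

theorem pairing_add_left {n : ℕ} (v w z : (Fin n → ZMod 2) × (Fin n → ZMod 2)) :
    pairing (v + w) z = pairing v z + pairing w z := by
  simp only [pairing, Prod.fst_add, Prod.snd_add, add_dotProduct]; ring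

theorem pairing_left_injective {n : ℕ} {v w : (Fin n → ZMod 2) × (Fin n → ZMod 2)}
    (h : ∀ z, pairing v z = pairing w z) : v = w := by
  ext i
  · simpa [pairing] using h (Pi.single i 1, 0)
  · simpa [pairing] using h (0, Pi.single i 1)

/-- The Walsh transform of a vectorial function, as a function of both frequencies. -/
def walshPair {n : ℕ} (F : (Fin n → ZMod 2) → (Fin n → ZMod 2))
    (w : (Fin n → ZMod 2) × (Fin n → ZMod 2)) : ℤ :=
  ∑ x, signChar (pairing w (x, F x))

theorem walsh_component {n : ℕ} (F : (Fin n → ZMod 2) → (Fin n → ZMod 2))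
    (u v : Fin n → ZMod 2) :
    walsh (fun x => dotp v (F x)) u = walshPair F (u, v) :=
  Finset.sum_congr rfl fun x _ => congrArg signChar (add_comm (dotp v (F x)) (dotp u x))

/-- The set of `v` whose component `v · F` is not bent. -/
def nonBent {n : ℕ} (F : (Fin n → ZMod 2) → (Fin n → ZMod 2)) : Set (Fin n → ZMod 2) :=
  {v | ¬ IsBent fun x => dotp v (F x)}

theorem mem_nonBent {n : ℕ} {F : (Fin n → ZMod 2) → (Fin n → ZMod 2)} {v : Fin n → ZMod 2} :
    v ∈ nonBent F ↔ ∃ u, walshPair F (u, v) ^ 2 ≠ 2 ^ n := by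
  simp [nonBent, IsBent, walsh_component]

theorem walshPair_zero {n : ℕ} (F : (Fin n → ZMod 2) → (Fin n → ZMod 2)) :
    walshPair F (0, 0) = 2 ^ n := by
  simp [walshPair, pairing, signChar_zero]

/-- A character sum over a subspace is divisible by the size of the subspace. -/
theorem card_dvd_sum_signChar {n : ℕ} (E : Submodule (ZMod 2) (Fin n → ZMod 2))
    [Fintype E] (y : Fin n → ZMod 2) :
    (Nat.card E : ℤ) ∣ ∑ v : E, signChar ((v : Fin n → ZMod 2) ⬝ᵥ y) := by
  by_cases h : ∀ v : E, (v : Fin n → ZMod 2) ⬝ᵥ y = 0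
  · simp [h, signChar_zero]
  · push Not at h
    obtain ⟨v₀, hv₀⟩ := h
    have key : ∑ v : E, signChar ((v : Fin n → ZMod 2) ⬝ᵥ y) =
        -∑ v : E, signChar ((v : Fin n → ZMod 2) ⬝ᵥ y) := by
      rw [← Finset.sum_neg_distrib, ← Equiv.sum_comp (Equiv.addRight v₀)]
      refine Finset.sum_congr rfl fun v _ => ?_
      simp [add_dotProduct, signChar_add, signChar_of_ne_zero hv₀]
    have : ∑ v : E, signChar ((v : Fin n → ZMod 2) ⬝ᵥ y) = 0 := by linarith
    simp [this]

theorem walshPair_of_ne_zero {n : ℕ} (F : (Fin n → ZMod 2) → (Fin n → ZMod 2))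
    {u : Fin n → ZMod 2} (hu : u ≠ 0) : walshPair F (u, 0) = 0 := by
  obtain ⟨i, hi⟩ := Function.ne_iff.mp hu
  have key : walshPair F (u, 0) = -walshPair F (u, 0) := by
    unfold walshPair
    rw [← Finset.sum_neg_distrib, ← Equiv.sum_comp (Equiv.addRight (Pi.single i 1))]
    refine Finset.sum_congr rfl fun x _ => ?_
    have : signChar (u i) = -1 := signChar_of_ne_zero hi
    simp [pairing, dotProduct_add, signChar_add, this]
  linarith

theorem zero_mem_nonBent {n : ℕ} (hn : 0 < n) (F : (Fin n → ZMod 2) → (Fin n → ZMod 2)) :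
    0 ∈ nonBent F := by
  refine mem_nonBent.2 ⟨0, ?_⟩
  rw [walshPair_zero, ← pow_mul]
  intro h
  have := (pow_right_inj₀ (by norm_num) (by norm_num)).1 h
  lia

/-- The Nyberg bound: a subspace of bent components has at most `2 ^ k` elements. -/
theorem card_le_of_disjoint_nonBent {k n : ℕ} (hk : 0 < k) (hn : n = 2 * k)
    (F : (Fin n → ZMod 2) → (Fin n → ZMod 2)) (E : Submodule (ZMod 2) (Fin n → ZMod 2))
    (hE : ∀ v ∈ E, v ≠ 0 → v ∉ nonBent F) : Nat.card E ≤ 2 ^ k := by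
  classical
  have := Fintype.ofFinite E
  by_contra! hlt
  have hcard : Nat.card E = 2 ^ Module.finrank (ZMod 2) E := by
    rw [Module.natCard_eq_pow_finrank (K := ZMod 2), Nat.card_zmod]
  rw [hcard] at hlt
  have hd : k + 1 ≤ Module.finrank (ZMod 2) E :=
    (Nat.pow_lt_pow_iff_right (by norm_num)).1 hlt
  have hpow : (2 : ℤ) ^ (k + 1) ∣ (Nat.card E : ℤ) := by
    rw [hcard]; push_cast; exact pow_dvd_pow 2 hd
  have hsum : (2 : ℤ) ^ (k + 1) ∣ ∑ v : E, walshPair F (0, (v : Fin n → ZMod 2)) := by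
    unfold walshPair
    rw [Finset.sum_comm]
    refine Finset.dvd_sum fun x _ => hpow.trans ?_
    simpa [pairing] using card_dvd_sum_signChar E (F x)
  have hsub : (2 : ℤ) ^ (k + 1) ∣
      ∑ v : E, (walshPair F (0, (v : Fin n → ZMod 2)) - 2 ^ k) := by
    rw [Finset.sum_sub_distrib]
    refine dvd_sub hsum ?_
    rw [Finset.sum_const, Finset.card_univ, nsmul_eq_mul, ← Nat.card_eq_fintype_card]
    exact hpow.mul_right _
  rw [← Finset.add_sum_erase _ _ (Finset.mem_univ (0 : E))] at hsub
  have hrest : (2 : ℤ) ^ (k + 1) ∣ ∑ v ∈ (Finset.univ : Finset E).erase 0,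
      (walshPair F (0, (v : Fin n → ZMod 2)) - 2 ^ k) := by
    refine Finset.dvd_sum fun v hv => ?_
    have hv0 : (v : Fin n → ZMod 2) ≠ 0 := by simpa using hv
    have hb := hE v v.2 hv0
    rw [mem_nonBent] at hb
    push Not at hb
    have h2 := hb 0
    rw [show (2 : ℤ) ^ n = (2 ^ k) ^ 2 by rw [hn, mul_comm, pow_mul], sq_eq_sq_iff_eq_or_eq_neg] at h2
    rcases h2 with h2 | h2
    · simp [h2]
    · rw [h2]; exact ⟨-1, by ring⟩
  have h0 := (dvd_add_left hrest).1 hsub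
  rw [Submodule.coe_zero, walshPair_zero] at h0
  have h1 : (2 : ℤ) ^ (k + 1) ∣ 2 ^ k :=
    (dvd_sub_right (pow_dvd_pow 2 (by lia : k + 1 ≤ n))).1 h0
  have := (pow_dvd_pow_iff (by norm_num : (2 : ℤ) ≠ 0) (by decide)).1 h1
  lia

/-- A subspace avoiding `T \ {0}` extends to one that together with `T` spans everything. -/
theorem exists_submodule_add_mem {n : ℕ} {T : Set (Fin n → ZMod 2)} (h0 : 0 ∈ T)
    (E₀ : Submodule (ZMod 2) (Fin n → ZMod 2)) (hE₀ : ∀ v ∈ E₀, v ≠ 0 → v ∉ T) :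
    ∃ E, E₀ ≤ E ∧ (∀ v ∈ E, v ≠ 0 → v ∉ T) ∧ ∀ v, ∃ e ∈ E, e + v ∈ T := by
  obtain ⟨E, hle, hmax⟩ := Finite.exists_le_maximal
    (p := fun E : Submodule (ZMod 2) (Fin n → ZMod 2) => ∀ v ∈ E, v ≠ 0 → v ∉ T) hE₀
  refine ⟨E, hle, hmax.prop, fun v => ?_⟩
  by_contra! hv
  have hvE : v ∉ E := fun h => hv v h (by rwa [ZModModule.add_self])
  refine hvE (hmax.2 (y := E ⊔ Submodule.span (ZMod 2) {v}) ?_ le_sup_left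
    (Submodule.mem_sup_right (Submodule.mem_span_singleton_self v)))
  intro t ht ht0
  obtain ⟨e, he, y, hy, rfl⟩ := Submodule.mem_sup.1 ht
  obtain ⟨a, rfl⟩ := Submodule.mem_span_singleton.1 hy
  obtain rfl | rfl := eq_zero_or_eq_one a
  · rw [zero_smul, add_zero] at ht0 ⊢
    exact hmax.prop e he ht0
  · rw [one_smul]
    exact hv e he

theorem surjective_add_of_add_mem {n : ℕ} {T : Set (Fin n → ZMod 2)}
    {E : Submodule (ZMod 2) (Fin n → ZMod 2)} (h : ∀ v, ∃ e ∈ E, e + v ∈ T) :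
    Function.Surjective fun p : E × T => (p.1 : Fin n → ZMod 2) + p.2 := by
  intro v
  obtain ⟨e, he, ht⟩ := h v
  exact ⟨(⟨e, he⟩, ⟨_, ht⟩), by simp [← add_assoc, ZModModule.add_self]⟩

theorem natCard_vec (n : ℕ) : Nat.card (Fin n → ZMod 2) = 2 ^ n := by simp

theorem two_pow_le_card {k n : ℕ} (hn : n = 2 * k) {T : Set (Fin n → ZMod 2)} (h0 : 0 ∈ T)
    (hT : ∀ E : Submodule (ZMod 2) (Fin n → ZMod 2),
      (∀ v ∈ E, v ≠ 0 → v ∉ T) → Nat.card E ≤ 2 ^ k) : 2 ^ k ≤ Nat.card T := by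
  obtain ⟨E, -, hE, hadd⟩ := exists_submodule_add_mem h0 ⊥ (by simp)
  have h := Nat.card_le_card_of_surjective _ (surjective_add_of_add_mem hadd)
  rw [natCard_vec, Nat.card_prod, show 2 ^ n = 2 ^ k * 2 ^ k by rw [hn, two_mul, pow_add]] at h
  exact Nat.le_of_mul_le_mul_left (h.trans (Nat.mul_le_mul_right _ (hT E hE))) (by positivity)

theorem add_mem_of_card_eq {k n : ℕ} (hn : n = 2 * k) {T : Set (Fin n → ZMod 2)} (h0 : 0 ∈ T)
    (hT : ∀ E : Submodule (ZMod 2) (Fin n → ZMod 2),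
      (∀ v ∈ E, v ≠ 0 → v ∉ T) → Nat.card E ≤ 2 ^ k)
    (hcard : Nat.card T = 2 ^ k) {a b : Fin n → ZMod 2} (ha : a ∈ T) (hb : b ∈ T) :
    a + b ∈ T := by
  by_contra hab
  obtain ⟨E, hle, hE, hadd⟩ := exists_submodule_add_mem h0
    (Submodule.span (ZMod 2) {a + b}) (by
      intro v hv hv0
      obtain ⟨c, rfl⟩ := Submodule.mem_span_singleton.1 hv
      obtain rfl | rfl := eq_zero_or_eq_one c
      · simp at hv0
      · rwa [one_smul])
  have hmem : a + b ∈ E := hle (Submodule.mem_span_singleton_self _)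
  have hle' : Nat.card (E × T) ≤ Nat.card (Fin n → ZMod 2) := by
    rw [natCard_vec, Nat.card_prod, hcard, show 2 ^ n = 2 ^ k * 2 ^ k by rw [hn, two_mul, pow_add]]
    exact Nat.mul_le_mul_right _ (hT E hE)
  have hinj := ((surjective_add_of_add_mem hadd).bijective_of_nat_card_le hle').1
  have := @hinj (0, ⟨b, hb⟩) (⟨a + b, hmem⟩, ⟨a, ha⟩) (by
    simp [add_right_comm a b a, ZModModule.add_self])
  have h : a + b = 0 := by simpa using (congrArg (fun p : E × T => (p.1 : Fin n → ZMod 2)) this).symm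
  exact hab (h ▸ h0)

/-- A linear automorphism of `F_2^n × F_2^n` has an adjoint for the standard pairing. -/
theorem exists_adjoint {n : ℕ} (A : ((Fin n → ZMod 2) × (Fin n → ZMod 2)) ≃ₗ[ZMod 2]
      ((Fin n → ZMod 2) × (Fin n → ZMod 2))) :
    ∃ B : (Fin n → ZMod 2) × (Fin n → ZMod 2) → (Fin n → ZMod 2) × (Fin n → ZMod 2),
      (∀ w z, pairing (B w) z = pairing w (A z)) ∧ (∀ v w, B (v + w) = B v + B w) ∧
        Function.Injective B := by
  have hex : ∀ w, ∃ w', ∀ z, pairing w' z = pairing w (A z) := by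
    intro w
    let φ : ((Fin n → ZMod 2) × (Fin n → ZMod 2)) →ₗ[ZMod 2] ZMod 2 :=
      { toFun := fun z => pairing w (A z)
        map_add' := fun y z => by rw [map_add, pairing_add_right]
        map_smul' := fun a z => by simp [pairing, mul_add] }
    refine ⟨(fun i => φ (Pi.single i 1, 0), fun i => φ (0, Pi.single i 1)), fun z => ?_⟩
    change _ = φ z
    have h1 := LinearMap.pi_apply_eq_sum_univ (φ ∘ₗ LinearMap.inl _ _ _) z.1
    have h2 := LinearMap.pi_apply_eq_sum_univ (φ ∘ₗ LinearMap.inr _ _ _) z.2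
    have h3 : φ z = φ (z.1, 0) + φ (0, z.2) := by rw [← map_add]; simp
    simp only [LinearMap.comp_apply, LinearMap.inl_apply, LinearMap.inr_apply] at h1 h2
    rw [h3, h1, h2]
    have hs : ∀ i : Fin n, (fun j => if i = j then (1 : ZMod 2) else 0) = Pi.single i 1 := by
      intro i; ext j; simp [Pi.single_apply, eq_comm]
    simp only [pairing, dotProduct, smul_eq_mul, mul_comm, hs]
  choose B hB using hex
  refine ⟨B, hB, fun v w => pairing_left_injective fun z => ?_, fun v w h =>
    pairing_left_injective fun z => ?_⟩
  · rw [pairing_add_left, hB, hB, hB, pairing_add_left]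
  · rw [← A.apply_symm_apply z, ← hB, ← hB, h]

theorem sum_range_graph {n : ℕ} (F : (Fin n → ZMod 2) → (Fin n → ZMod 2))
    (g : (Fin n → ZMod 2) × (Fin n → ZMod 2) → ℤ) :
    ∑ x, g (x, F x) = ∑ᶠ z ∈ Set.range fun x => (x, F x), g z := by
  rw [finsum_mem_range fun x y h => (Prod.ext_iff.1 h).1, finsum_eq_sum_of_fintype]

theorem walshPair_sq_of_image_graph {n : ℕ} {F F'' : (Fin n → ZMod 2) → (Fin n → ZMod 2)}
    {A : ((Fin n → ZMod 2) × (Fin n → ZMod 2)) ≃ₗ[ZMod 2]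
      ((Fin n → ZMod 2) × (Fin n → ZMod 2))}
    {c : (Fin n → ZMod 2) × (Fin n → ZMod 2)}
    (h : (fun z => A z + c) '' (Set.range fun x => (x, F x)) = Set.range fun x => (x, F'' x))
    {B : (Fin n → ZMod 2) × (Fin n → ZMod 2) → (Fin n → ZMod 2) × (Fin n → ZMod 2)}
    (hB : ∀ w z, pairing (B w) z = pairing w (A z)) (w : (Fin n → ZMod 2) × (Fin n → ZMod 2)) :
    walshPair F'' w ^ 2 = walshPair F (B w) ^ 2 := by
  have hinj : Function.Injective fun z => A z + c :=
    (add_left_injective c).comp A.injective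
  have key : walshPair F'' w = walshPair F (B w) * signChar (pairing w c) := by
    unfold walshPair
    rw [sum_range_graph F'' fun z => signChar (pairing w z), ← h,
      finsum_mem_image hinj.injOn, ← sum_range_graph F fun z => signChar (pairing w (A z + c)),
      Finset.sum_mul]
    exact Finset.sum_congr rfl fun x _ => by rw [pairing_add_right, signChar_add, hB]
  rw [key, mul_pow, signChar_sq, mul_one]

theorem card_nonBent_le_of_image_graph {n : ℕ} (hn : 0 < n)
    {F F'' : (Fin n → ZMod 2) → (Fin n → ZMod 2)}
    {A : ((Fin n → ZMod 2) × (Fin n → ZMod 2)) ≃ₗ[ZMod 2]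
      ((Fin n → ZMod 2) × (Fin n → ZMod 2))}
    {c : (Fin n → ZMod 2) × (Fin n → ZMod 2)}
    (h : (fun z => A z + c) '' (Set.range fun x => (x, F x)) = Set.range fun x => (x, F'' x))
    (hadd : ∀ a ∈ nonBent F, ∀ b ∈ nonBent F, a + b ∈ nonBent F) :
    Nat.card (nonBent F'') ≤ Nat.card (nonBent F) := by
  obtain ⟨B, hB, hBadd, hBinj⟩ := exists_adjoint A
  have hmem : ∀ w, walshPair F'' w ^ 2 ≠ 2 ^ n → (B w).2 ∈ nonBent F := fun w hw =>
    mem_nonBent.2 ⟨(B w).1, by rwa [walshPair_sq_of_image_graph h hB] at hw⟩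
  have hhor : ∀ u, (B (u, 0)).2 ∈ nonBent F := by
    intro u
    by_cases hu : u = 0
    · have hB0 : B 0 = 0 := by simpa using hBadd 0 0
      subst hu
      rw [← Prod.zero_eq_mk, hB0]
      exact zero_mem_nonBent hn F
    · refine hmem _ ?_
      rw [walshPair_of_ne_zero F'' hu, zero_pow two_ne_zero]
      positivity
  have hall : ∀ u, ∀ v ∈ nonBent F'', (B (u, v)).2 ∈ nonBent F := by
    intro u v hv
    obtain ⟨u', hu'⟩ := mem_nonBent.1 hv
    have h1 := hadd _ (hmem _ hu') _ (hhor (u' + u))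
    rwa [← Prod.snd_add, ← hBadd, Prod.mk_add_mk, add_zero, ← add_assoc,
      ZModModule.add_self, zero_add] at h1
  have hle := Nat.card_le_card_of_injective
    (fun p : (Fin n → ZMod 2) × nonBent F'' =>
      (((B (p.1, p.2)).1, ⟨(B (p.1, p.2)).2, hall p.1 p.2 p.2.2⟩) :
        (Fin n → ZMod 2) × nonBent F)) (by
      rintro ⟨u, v⟩ ⟨u', v'⟩ h
      simp only [Prod.mk.injEq, Subtype.mk.injEq] at h
      have := hBinj (Prod.ext h.1 h.2)
      simpa [Subtype.ext_iff] using this)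
  rw [Nat.card_prod, Nat.card_prod] at hle
  exact Nat.le_of_mul_le_mul_left hle Nat.card_pos

theorem card_bent_eq_iff {k n : ℕ} (hk : 0 < k) (hn : n = 2 * k)
    (F : (Fin n → ZMod 2) → (Fin n → ZMod 2)) :
    Nat.card {v : Fin n → ZMod 2 // v ≠ 0 ∧ IsBent fun x => dotp v (F x)} = 2 ^ n - 2 ^ k ↔
      Nat.card (nonBent F) = 2 ^ k := by
  have hset : {v : Fin n → ZMod 2 | v ≠ 0 ∧ IsBent fun x => dotp v (F x)} = (nonBent F)ᶜ := by
    ext v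
    have h0 := zero_mem_nonBent (by lia) F
    simp only [nonBent, Set.mem_ofPred_eq, Set.mem_compl_iff, not_not] at h0 ⊢
    exact ⟨And.right, fun h => ⟨fun hv => h0 (hv ▸ h), h⟩⟩
  have hc : Nat.card {v : Fin n → ZMod 2 // v ≠ 0 ∧ IsBent fun x => dotp v (F x)} =
      (nonBent F)ᶜ.ncard := by
    rw [← hset]; rfl
  have hadd := Set.ncard_add_ncard_compl (nonBent F)
  rw [natCard_vec] at hadd
  have hpow : 2 ^ k ≤ 2 ^ n := Nat.pow_le_pow_right (by norm_num) (by lia)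
  rw [hc, Nat.card_coe_set_eq]
  lia

theorem card_nonBent_eq_of_image_graph {k n : ℕ} (hk : 0 < k) (hn : n = 2 * k)
    {F F'' : (Fin n → ZMod 2) → (Fin n → ZMod 2)}
    {A : ((Fin n → ZMod 2) × (Fin n → ZMod 2)) ≃ₗ[ZMod 2]
      ((Fin n → ZMod 2) × (Fin n → ZMod 2))}
    {c : (Fin n → ZMod 2) × (Fin n → ZMod 2)}
    (h : (fun z => A z + c) '' (Set.range fun x => (x, F x)) = Set.range fun x => (x, F'' x))
    (hF : Nat.card (nonBent F) = 2 ^ k) : Nat.card (nonBent F'') = 2 ^ k := by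
  have hn0 : 0 < n := by lia
  refine le_antisymm ((card_nonBent_le_of_image_graph hn0 h fun a ha b hb => ?_).trans_eq hF) ?_
  · exact add_mem_of_card_eq hn (zero_mem_nonBent hn0 F)
      (card_le_of_disjoint_nonBent hk hn F) hF ha hb
  · exact two_pow_le_card hn (zero_mem_nonBent hn0 F'') (card_le_of_disjoint_nonBent hk hn F'')

theorem stmt_0 (k n : ℕ) (hk : 0 < k) (hn : n = 2 * k)
    (F F'' : (Fin n → ZMod 2) → (Fin n → ZMod 2))
    (hCCZ : ∃ (A : ((Fin n → ZMod 2) × (Fin n → ZMod 2)) ≃ₗ[ZMod 2]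
        ((Fin n → ZMod 2) × (Fin n → ZMod 2)))
        (c : (Fin n → ZMod 2) × (Fin n → ZMod 2)),
      (fun z => A z + c) '' (Set.range fun x => (x, F x)) =
        (Set.range fun x => (x, F'' x))) :
    Nat.card {v : Fin n → ZMod 2 // v ≠ 0 ∧ IsBent fun x => dotp v (F x)} = 2 ^ n - 2 ^ k ↔
    Nat.card {v : Fin n → ZMod 2 // v ≠ 0 ∧ IsBent fun x => dotp v (F'' x)} = 2 ^ n - 2 ^ k := by
  obtain ⟨A, c, h⟩ := hCCZ
  rw [card_bent_eq_iff hk hn, card_bent_eq_iff hk hn]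
  refine ⟨card_nonBent_eq_of_image_graph hk hn h,
    card_nonBent_eq_of_image_graph hk hn (A := A.symm) (c := A.symm c) ?_⟩
  rw [← h, Set.image_image]
  convert Set.image_id _ using 2
  ext1 z
  rw [map_add, A.symm_apply_apply, add_assoc, ZModModule.add_self, add_zero, id]
end

section
/- Let n ≥ 2 and let F : F_2^n → F_2^n be an APN function. Then the fourth power moment of the extended Walsh transform satisfies ∑_{u ∈ F_2^n} ∑_{v ∈ F_2^n} W_F(u,v)^4 = 2^{3n} · (3 · 2^n − 2). -/
open Finset

/-- The extended Walsh transform of `F : F_2^n → F_2^n` at `(u, v)`. -/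
def walshF {n : ℕ} (F : (Fin n → ZMod 2) → (Fin n → ZMod 2))
    (u v : Fin n → ZMod 2) : ℤ :=
  ∑ x : Fin n → ZMod 2, (-1 : ℤ) ^ (dotp v (F x) + dotp u x).val

/-- `F` is APN: every derivative equation has at most 2 solutions. -/
def IsAPN {n : ℕ} (F : (Fin n → ZMod 2) → (Fin n → ZMod 2)) : Prop :=
  ∀ a : Fin n → ZMod 2, a ≠ 0 → ∀ b : Fin n → ZMod 2,
    Nat.card {x : Fin n → ZMod 2 // F (x + a) + F x = b} ≤ 2

/-- The sign `(-1)^a` of an element of `F_2`. -/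
def signF2 (a : ZMod 2) : ℤ := (-1) ^ a.val

lemma signF2_add (a b : ZMod 2) : signF2 (a + b) = signF2 a * signF2 b := by
  revert a b; decide

lemma F2_vec_add_self {n : ℕ} (a : Fin n → ZMod 2) : a + a = 0 :=
  funext fun _ => CharTwo.add_self_eq_zero _

lemma F2_vec_add_eq_zero_iff {n : ℕ} {a b : Fin n → ZMod 2} : a + b = 0 ↔ a = b := by
  constructor
  · intro h
    exact add_right_cancel (h.trans (F2_vec_add_self b).symm)
  · rintro rfl
    exact F2_vec_add_self a

lemma dotp_add_right {n : ℕ} (v x y : Fin n → ZMod 2) :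
    dotp v (x + y) = dotp v x + dotp v y := by
  simp [dotp, mul_add, sum_add_distrib]

lemma dotp_add_left {n : ℕ} (u v x : Fin n → ZMod 2) :
    dotp (u + v) x = dotp u x + dotp v x := by
  simp [dotp, add_mul, sum_add_distrib]

/-- Orthogonality of the characters of `F_2^n`. -/
lemma sum_signF2_dotp {n : ℕ} (s : Fin n → ZMod 2) :
    ∑ u : Fin n → ZMod 2, signF2 (dotp u s) = if s = 0 then 2 ^ n else 0 := by
  split_ifs with h
  · subst h
    simp [dotp, signF2]
  · obtain ⟨i, hi⟩ := Function.ne_iff.mp h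
    have h_shift := Equiv.sum_comp (Equiv.addRight (Pi.single i (1 : ZMod 2)))
      fun u : Fin n → ZMod 2 => signF2 (dotp u s)
    have h_one : dotp (Pi.single i (1 : ZMod 2)) s = 1 := by
      have h_coord : ∀ a : ZMod 2, a ≠ 0 → a = 1 := by decide
      simp [dotp, Pi.single_apply, h_coord (s i) hi]
    have h_sign : signF2 1 = -1 := by decide
    simp only [Equiv.coe_addRight, dotp_add_left, signF2_add, h_one, h_sign, mul_neg, mul_one,
      sum_neg_distrib] at h_shift
    linarith

lemma walshF_sq {n : ℕ} (F : (Fin n → ZMod 2) → (Fin n → ZMod 2)) (u v : Fin n → ZMod 2) :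
    walshF F u v ^ 2 = ∑ p : (Fin n → ZMod 2) × (Fin n → ZMod 2),
      signF2 (dotp v (F p.1 + F p.2)) * signF2 (dotp u (p.1 + p.2)) := by
  have h : walshF F u v = ∑ x, signF2 (dotp v (F x)) * signF2 (dotp u x) :=
    sum_congr rfl fun x _ => signF2_add _ _
  rw [h, sq, sum_mul_sum, Fintype.sum_prod_type]
  refine sum_congr rfl fun x _ => sum_congr rfl fun y _ => ?_
  simp only [dotp_add_right, signF2_add]
  ring

/-- The fourth moment of the Walsh transform counts pairs of pairs with equal sums. -/
lemma sum_walshF_pow_four {n : ℕ} (F : (Fin n → ZMod 2) → (Fin n → ZMod 2)) :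
    ∑ u : Fin n → ZMod 2, ∑ v : Fin n → ZMod 2, walshF F u v ^ 4 =
      2 ^ n * 2 ^ n * ∑ p : (Fin n → ZMod 2) × (Fin n → ZMod 2),
        (#{q : (Fin n → ZMod 2) × (Fin n → ZMod 2) |
          p.1 + p.2 = q.1 + q.2 ∧ F p.1 + F p.2 = F q.1 + F q.2} : ℤ) := by
  have h (u v : Fin n → ZMod 2) : walshF F u v ^ 4 =
      ∑ p : (Fin n → ZMod 2) × (Fin n → ZMod 2), ∑ q : (Fin n → ZMod 2) × (Fin n → ZMod 2),
        signF2 (dotp u (p.1 + p.2 + (q.1 + q.2))) *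
          signF2 (dotp v (F p.1 + F p.2 + (F q.1 + F q.2))) := by
    rw [show walshF F u v ^ 4 = walshF F u v ^ 2 * walshF F u v ^ 2 by ring, walshF_sq,
      sum_mul_sum]
    refine sum_congr rfl fun p _ => sum_congr rfl fun q _ => ?_
    rw [dotp_add_right u (p.1 + p.2), dotp_add_right v (F p.1 + F p.2), signF2_add, signF2_add]
    ring
  simp_rw [h]
  rw [sum_congr rfl fun u _ => sum_comm, sum_comm, mul_sum]
  refine sum_congr rfl fun p _ => ?_
  rw [sum_congr rfl fun u _ => sum_comm, sum_comm, card_filter, Nat.cast_sum, mul_sum]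
  refine sum_congr rfl fun q _ => ?_
  rw [← sum_mul_sum, sum_signF2_dotp, sum_signF2_dotp]
  simp only [F2_vec_add_eq_zero_iff, ite_and]
  split_ifs <;> simp

lemma IsAPN.card_pairs {n : ℕ} {F : (Fin n → ZMod 2) → (Fin n → ZMod 2)} (hF : IsAPN F)
    (x y : Fin n → ZMod 2) :
    #{q : (Fin n → ZMod 2) × (Fin n → ZMod 2) |
      x + y = q.1 + q.2 ∧ F x + F y = F q.1 + F q.2} = if x = y then 2 ^ n else 2 := by
  split_ifs with h
  · subst h
    have h_diag : ({q : (Fin n → ZMod 2) × (Fin n → ZMod 2) |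
        x + x = q.1 + q.2 ∧ F x + F x = F q.1 + F q.2} : Finset _) =
        univ.image fun z => (z, z) := by
      ext ⟨z, w⟩
      simp only [F2_vec_add_self, mem_filter, mem_univ, true_and, mem_image, Prod.mk.injEq,
        eq_comm (a := (0 : Fin n → ZMod 2)), F2_vec_add_eq_zero_iff, exists_eq_left]
      exact ⟨fun h => h.1, fun h => ⟨h, congrArg F h⟩⟩
    rw [h_diag, card_image_of_injective _ fun a b hab => (Prod.mk.inj hab).1]
    simp
  · apply le_antisymm
    · have h_le := hF (x + y) (mt F2_vec_add_eq_zero_iff.mp h) (F x + F y)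
      rw [Nat.card_eq_fintype_card, Fintype.card_subtype] at h_le
      refine le_trans (card_le_card_of_injOn Prod.fst ?_ ?_) h_le
      · rintro ⟨z, w⟩ hq
        simp only [coe_filter, mem_univ, true_and, Set.mem_ofPred_eq] at hq ⊢
        rw [hq.1, hq.2, ← add_assoc, F2_vec_add_self, zero_add, add_comm]
      · rintro ⟨z, w⟩ hq ⟨z', w'⟩ hq' hz
        simp only [coe_filter, mem_univ, true_and, Set.mem_ofPred_eq] at hq hq' hz
        subst hz
        rw [add_left_cancel (hq.1.symm.trans hq'.1)]
    · have h_ne : (x, y) ≠ (y, x) := fun h_eq => h (Prod.mk.inj h_eq).1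
      refine (card_pair h_ne).ge.trans (card_le_card ?_)
      intro q hq
      rcases mem_insert.mp hq with rfl | hq
      · simp
      · rw [mem_singleton.mp hq]
        simp [add_comm]

theorem stmt_2 (n : ℕ) (hn : 2 ≤ n)
    (F : (Fin n → ZMod 2) → (Fin n → ZMod 2)) (hAPN : IsAPN F) :
    ∑ u : Fin n → ZMod 2, ∑ v : Fin n → ZMod 2, (walshF F u v) ^ 4 =
      2 ^ (3 * n) * (3 * 2 ^ n - 2) := by
  rw [sum_walshF_pow_four, Fintype.sum_prod_type]
  simp only [hAPN.card_pairs]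
  have h_row (x : Fin n → ZMod 2) :
      ∑ y, ((if x = y then 2 ^ n else 2 : ℕ) : ℤ) = 3 * 2 ^ n - 2 := by
    have h_split (y : Fin n → ZMod 2) : ((if x = y then 2 ^ n else 2 : ℕ) : ℤ) =
        (if x = y then 2 ^ n - 2 else 0) + 2 := by
      split_ifs <;> simp
    simp only [h_split, sum_add_distrib, sum_ite_eq, mem_univ, if_true, sum_const, card_univ,
      Fintype.card_pi, ZMod.card, prod_const, Fintype.card_fin, nsmul_eq_mul, Nat.cast_pow,
      Nat.cast_ofNat]
    ring
  simp only [h_row, sum_const, card_univ, Fintype.card_pi, ZMod.card, prod_const,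
    Fintype.card_fin, nsmul_eq_mul, Nat.cast_pow, Nat.cast_ofNat]
  ring
end

section
/- Let k ≥ 2, let F = GaloisField 2 (2k), set t1 = 1, and let t2 be an integer with 1 ≤ t2 ≤ k and gcd(t2, k) ≠ 1. Define G(x) = x^{2^{t2}} (x + x^{2^k} + x^{2^{t1}} + x^{2^{t1+k}} + x^{2^{t2}} + x^{2^{t2+k}}). Then for every a ∈ F with a + a^{2^k} = 1 (such a exists and satisfies a^{2^k} ≠ a) and for every b ∈ F, the set {x ∈ F : G(x) + G(x+a) = b} has at most 2 elements; in particular its cardinality never equals 2^{gcd(t2,k)} and never equals 2^k. -/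
open Finset

/-- A field of order `2 ^ (2 * k)` contains an element of relative trace `1` over its subfield of
order `2 ^ k`. -/
theorem exists_add_pow_two_pow_eq_one {K : Type*} [Field K] [CharP K 2] {k : ℕ} (hk : 0 < k)
    (hcard : Nat.card K = 2 ^ (2 * k)) (hfix : ∀ x : K, (x ^ 2 ^ k) ^ 2 ^ k = x) :
    ∃ a : K, a + a ^ 2 ^ k = 1 := by
  have h1 : 1 < 2 ^ k := Nat.one_lt_two_pow hk.ne'
  obtain ⟨x, hx⟩ : ∃ x : K, x + x ^ 2 ^ k ≠ 0 := by
    by_contra! h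
    have hfin : Finite K := Nat.finite_of_card_ne_zero (by rw [hcard]; positivity)
    have := Fintype.ofFinite K
    have hdeg := FiniteField.X_pow_card_sub_X_natDegree_eq K h1
    have hne := FiniteField.X_pow_card_sub_X_ne_zero K h1
    have hle := Polynomial.card_le_degree_of_subset_roots
      (p := (Polynomial.X ^ 2 ^ k - Polynomial.X : Polynomial K)) (Z := Finset.univ) (by
        intro x _
        rw [Polynomial.mem_roots hne]
        simp [(CharTwo.add_eq_zero.mp (h x)).symm])
    rw [hdeg, Finset.card_univ, ← Nat.card_eq_fintype_card, hcard] at hle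
    exact absurd hle (not_le.mpr (Nat.pow_lt_pow_right (by norm_num) (by omega)))
  refine ⟨x / (x + x ^ 2 ^ k), ?_⟩
  have ht : (x + x ^ 2 ^ k) ^ 2 ^ k = x + x ^ 2 ^ k := by
    rw [add_pow_char_pow, hfix, add_comm]
  rw [div_pow, ht, ← add_div, div_self hx]

/-- If `a` has relative trace `1` and the derivative in direction `a` of
`x ^ 2 ^ t * (T x + T x ^ 2 + T x ^ 2 ^ t)`, with `T x = x + x ^ 2 ^ k`, vanishes linearly at `d`,
then `d ∈ {0, a}`. -/
theorem eq_zero_or_eq_of_pow_two_pow_eq {K : Type*} [Field K] [CharP K 2] {k t : ℕ}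
    (hfix : ∀ x : K, (x ^ 2 ^ k) ^ 2 ^ k = x) {a d : K} (ha : a + a ^ 2 ^ k = 1)
    (hd : d ^ 2 ^ t = a ^ 2 ^ t *
      ((d + d ^ 2 ^ k) + (d + d ^ 2 ^ k) ^ 2 + (d + d ^ 2 ^ k) ^ 2 ^ t)) :
    d = 0 ∨ d = a := by
  set T := d + d ^ 2 ^ k with hT
  have hTk : T ^ 2 ^ k = T := by rw [hT, add_pow_char_pow, hfix, add_comm]
  have hLk : (T + T ^ 2 + T ^ 2 ^ t) ^ 2 ^ k = T + T ^ 2 + T ^ 2 ^ t := by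
    rw [add_pow_char_pow, add_pow_char_pow, pow_right_comm T 2, pow_right_comm T (2 ^ t), hTk]
  have hTt : T ^ 2 ^ t = T + T ^ 2 + T ^ 2 ^ t := by
    calc T ^ 2 ^ t = d ^ 2 ^ t + (d ^ 2 ^ t) ^ 2 ^ k := by
          rw [hT, add_pow_char_pow, pow_right_comm]
      _ = (a + a ^ 2 ^ k) ^ 2 ^ t * (T + T ^ 2 + T ^ 2 ^ t) := by
          rw [hd, mul_pow, hLk, add_pow_char_pow a, pow_right_comm a (2 ^ k)]
          ring
      _ = _ := by rw [ha, one_pow, one_mul]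
  have hT01 : T * (T + 1) = 0 := by linear_combination -hTt
  have hda : d = a * T := by
    apply iterateFrobenius_inj K 2 t
    rw [iterateFrobenius_def, iterateFrobenius_def, mul_pow, hd, ← hTt]
  rcases mul_eq_zero.mp hT01 with h | h
  · left; rw [hda, h, mul_zero]
  · right; rw [CharTwo.add_eq_zero.mp h, mul_one] at hda; exact hda

theorem stmt_13 (k : ℕ) (hk : 2 ≤ k) (t2 : ℕ) (ht2 : 1 ≤ t2) (ht2k : t2 ≤ k)
    (hgcd : Nat.gcd t2 k ≠ 1)
    (G : GaloisField 2 (2 * k) → GaloisField 2 (2 * k))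
    (hGdef : ∀ x, G x = x ^ 2 ^ t2 *
      (x + x ^ 2 ^ k + x ^ 2 ^ 1 + x ^ 2 ^ (1 + k) + x ^ 2 ^ t2 + x ^ 2 ^ (t2 + k))) :
    (∃ a : GaloisField 2 (2 * k), a + a ^ 2 ^ k = 1) ∧
    ∀ a : GaloisField 2 (2 * k), a + a ^ 2 ^ k = 1 →
      a ^ 2 ^ k ≠ a ∧
      ∀ b : GaloisField 2 (2 * k),
        Nat.card {x : GaloisField 2 (2 * k) // G x + G (x + a) = b} ≤ 2 ∧
        Nat.card {x : GaloisField 2 (2 * k) // G x + G (x + a) = b} ≠ 2 ^ Nat.gcd t2 k ∧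
        Nat.card {x : GaloisField 2 (2 * k) // G x + G (x + a) = b} ≠ 2 ^ k := by
  have hcard : Nat.card (GaloisField 2 (2 * k)) = 2 ^ (2 * k) :=
    GaloisField.card 2 (2 * k) (by omega)
  have hfix (x : GaloisField 2 (2 * k)) : (x ^ 2 ^ k) ^ 2 ^ k = x := by
    have := Fintype.ofFinite (GaloisField 2 (2 * k))
    rw [← pow_mul, ← pow_add, ← two_mul, ← hcard, Nat.card_eq_fintype_card, FiniteField.pow_card]
  refine ⟨exists_add_pow_two_pow_eq_one (by omega) hcard hfix,
    fun a ha => ⟨fun h => ?_, fun b => ?_⟩⟩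
  · rw [h, CharTwo.add_self_eq_zero] at ha
    exact zero_ne_one ha
  have hG (x) : G x = x ^ 2 ^ t2 *
      ((x + x ^ 2 ^ k) + (x + x ^ 2 ^ k) ^ 2 + (x + x ^ 2 ^ k) ^ 2 ^ t2) := by
    rw [hGdef, CharTwo.add_sq, add_pow_char_pow]
    ring
  have hder (x) : G x + G (x + a) = x ^ 2 ^ t2 + a ^ 2 ^ t2 *
      ((x + x ^ 2 ^ k) + (x + x ^ 2 ^ k) ^ 2 + (x + x ^ 2 ^ k) ^ 2 ^ t2 + 1) := by
    have hT : x + a + (x + a) ^ 2 ^ k = x + x ^ 2 ^ k + 1 := by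
      rw [add_pow_char_pow, ← ha]; ring
    rw [hG, hG, hT, CharTwo.add_sq _ 1, add_pow_char_pow x a, add_pow_char_pow _ 1, one_pow]
    generalize x + x ^ 2 ^ k = T
    linear_combination (x ^ 2 ^ t2 * (T + T ^ 2 + T ^ 2 ^ t2 + 1) + a ^ 2 ^ t2) *
      CharTwo.two_eq_zero (R := GaloisField 2 (2 * k))
  have hle : Nat.card {x : GaloisField 2 (2 * k) // G x + G (x + a) = b} ≤ 2 := by
    rcases isEmpty_or_nonempty {x : GaloisField 2 (2 * k) // G x + G (x + a) = b} with h | ⟨y, hy⟩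
    · simp
    have hsub : {x | G x + G (x + a) = b} ⊆ {y, y + a} := by
      intro x hx
      have hxy : G x + G (x + a) = G y + G (y + a) := hx.trans hy.symm
      rw [hder, hder] at hxy
      have hd := eq_zero_or_eq_of_pow_two_pow_eq (t := t2) (d := x - y) hfix ha (by
        have hT : x - y + (x - y) ^ 2 ^ k = (x + x ^ 2 ^ k) - (y + y ^ 2 ^ k) := by
          rw [sub_pow_char_pow]; ring
        rw [hT, sub_pow_char_pow, sub_pow_char_pow, sub_pow_char]
        generalize x + x ^ 2 ^ k = X at hxy ⊢
        generalize y + y ^ 2 ^ k = Y at hxy ⊢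
        linear_combination hxy - a ^ 2 ^ t2 * (X - Y + (X ^ 2 - Y ^ 2) + (X ^ 2 ^ t2 - Y ^ 2 ^ t2)) *
          CharTwo.two_eq_zero (R := GaloisField 2 (2 * k)))
      rcases hd with h | h
      · left; exact sub_eq_zero.mp h
      · right; rw [Set.mem_singleton_iff, ← h]; ring
    exact (Set.ncard_le_ncard hsub).trans ((Set.ncard_insert_le _ _).trans_eq (by simp))
  have hlt {m : ℕ} (hm : 2 ≤ m) : 2 < 2 ^ m :=
    lt_of_lt_of_le (by norm_num) (Nat.pow_le_pow_right (n := 2) (by norm_num) hm)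
  have hpos : 0 < Nat.gcd t2 k := Nat.gcd_pos_of_pos_left _ ht2
  exact ⟨hle, (hle.trans_lt (hlt (by omega))).ne, (hle.trans_lt (hlt hk)).ne⟩
end

section
/- Let k ≥ 1, let F = GaloisField 2 (2k), let i ≥ 0 and ρ be integers with 1 ≤ ρ ≤ k, and let t1, …, tρ be integers with 0 ≤ tj ≤ k. Assume that the only z in the subfield F_{2^k} with ∑_{j=1}^{ρ} z^{2^{k−tj}} + z = 0 is z = 0, and the only z ∈ F_{2^k} with ∑_{j=1}^{ρ} z^{2^{tj}} + z = 0 is z = 0. Define G(x) = x^{2^i} ((x + x^{2^k}) + ∑_{j=1}^{ρ} (x + x^{2^k})^{2^{tj}}). If the number of z ∈ F_{2^k} satisfying z^{2^i} + z + ∑_{j=1}^{ρ} z^{2^{tj}} = 0 is not equal to 2^{gcd(i,k)}, then for every a ∈ F with a + a^{2^k} = 1 and every b ∈ F, the cardinality of {x ∈ F : G(x) + G(x+a) = b} is not equal to 2^{gcd(i,k)}. -/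
open Finset

/-- If `L` and `T = x + σ x` are additive, `L` commutes with `σ`, and `a + σ a = 1`, then a
nonempty fibre of `x ↦ φ a * L (T x) + φ x` is in bijection with the `σ`-fixed solutions
of `φ z = L z`. -/
theorem card_fiber_eq_card_fixed {F : Type*} [Field F] [CharP F 2] (σ φ : F →+* F) (L : F →+ F)
    (hσ : ∀ x, σ (σ x) = x) (hσφ : ∀ x, σ (φ x) = φ (σ x)) (hσL : ∀ x, σ (L x) = L (σ x))
    {a : F} (ha : a + σ a = 1) (x₀ : F) :
    Nat.card {x : F // φ a * L (x + σ x) + φ x = φ a * L (x₀ + σ x₀) + φ x₀} =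
      Nat.card {z : F // σ z = z ∧ φ z = L z} := by
  have h2 : ∀ x : F, x + x = 0 := CharTwo.add_self_eq_zero
  have fixed : ∀ y, σ (y + σ y) = y + σ y := fun y => by rw [map_add, hσ, add_comm]
  have key : ∀ y, φ y = φ a * L (y + σ y) → φ (y + σ y) = L (y + σ y) := fun y hy => by
    have hs : φ (σ y) = φ (σ a) * L (y + σ y) := by
      rw [← hσφ, hy, map_mul, hσφ, hσL, fixed]
    rw [map_add, hs, hy, ← add_mul, ← map_add, ha, map_one, one_mul]
  have diff : ∀ x, φ a * L (x + σ x) + φ x = φ a * L (x₀ + σ x₀) + φ x₀ →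
      φ (x + x₀) = φ a * L ((x + x₀) + σ (x + x₀)) := fun x hx => by
    rw [map_add σ, add_add_add_comm, map_add L, map_add φ]
    linear_combination hx + h2 (φ x₀) - h2 (φ a * L (x + σ x))
  have trace : ∀ z, σ z = z → a * z + σ (a * z) = z := fun z hz => by
    rw [map_mul, hz, ← add_mul, ha, one_mul]
  refine Nat.card_congr
    { toFun := fun x => ⟨(x + x₀) + σ (x + x₀), fixed _, key _ (diff x.1 x.2)⟩
      invFun := fun z => ⟨x₀ + a * z, ?_⟩
      left_inv := ?_
      right_inv := ?_ }
  · obtain ⟨z, hz, hφ⟩ := z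
    rw [map_add σ, add_add_add_comm, trace z hz, map_add L, map_add φ, map_mul, hφ]
    linear_combination h2 (φ a * L z)
  · rintro ⟨x, hx⟩
    have e : a * ((x + x₀) + σ (x + x₀)) = x + x₀ := φ.injective <| by
      rw [map_mul, key _ (diff x hx), ← diff x hx]
    refine Subtype.ext ?_
    change x₀ + a * ((x + x₀) + σ (x + x₀)) = x
    rw [e]
    linear_combination h2 x₀
  · rintro ⟨z, hz, hφ⟩
    refine Subtype.ext ?_
    change (x₀ + a * z + x₀) + σ (x₀ + a * z + x₀) = z
    have e : x₀ + a * z + x₀ = a * z := by linear_combination h2 x₀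
    rw [e, trace z hz]

theorem stmt_14 (k : ℕ) (hk : 1 ≤ k) (i ρ : ℕ) (hρ1 : 1 ≤ ρ) (hρk : ρ ≤ k)
    (t : Fin ρ → ℕ) (ht : ∀ j, t j ≤ k)
    (h1 : ∀ z : GaloisField 2 (2 * k), z ^ 2 ^ k = z →
      (∑ j, z ^ 2 ^ (k - t j)) + z = 0 → z = 0)
    (h2 : ∀ z : GaloisField 2 (2 * k), z ^ 2 ^ k = z →
      (∑ j, z ^ 2 ^ (t j)) + z = 0 → z = 0)
    (G : GaloisField 2 (2 * k) → GaloisField 2 (2 * k))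
    (hGdef : ∀ x, G x = x ^ 2 ^ i *
      ((x + x ^ 2 ^ k) + ∑ j, (x + x ^ 2 ^ k) ^ 2 ^ (t j)))
    (hsol : Nat.card {z : GaloisField 2 (2 * k) //
        z ^ 2 ^ k = z ∧ z ^ 2 ^ i + z + ∑ j, z ^ 2 ^ (t j) = 0} ≠ 2 ^ Nat.gcd i k) :
    ∀ a : GaloisField 2 (2 * k), a + a ^ 2 ^ k = 1 →
      ∀ b : GaloisField 2 (2 * k),
        Nat.card {x : GaloisField 2 (2 * k) // G x + G (x + a) = b} ≠ 2 ^ Nat.gcd i k := by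
  intro a ha b
  let F := GaloisField 2 (2 * k)
  let φ : ℕ → F →+* F := fun n => iterateFrobenius F 2 n
  have hφ : ∀ n x, φ n x = x ^ 2 ^ n := fun n x => iterateFrobenius_def 2 n x
  have hcomm : ∀ m n x, φ m (φ n x) = φ n (φ m x) := fun m n x => by
    simp only [hφ, ← pow_mul, mul_comm]
  let L : F →+ F := AddMonoidHom.id F + ∑ j, (φ (t j)).toAddMonoidHom
  have hL : ∀ x, L x = x + ∑ j, φ (t j) x := fun x => by simp [L]
  have hL' : ∀ x, L x = x + ∑ j, x ^ 2 ^ t j := fun x => by simp only [hL, hφ]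
  have hσ : ∀ x, φ k (φ k x) = x := fun x => by
    have := Fintype.ofFinite F
    have hc : Fintype.card F = 2 ^ (2 * k) := by
      rw [← Nat.card_eq_fintype_card]; exact GaloisField.card 2 (2 * k) (by omega)
    rw [hφ, hφ, ← pow_mul, ← pow_add, ← two_mul, ← hc, FiniteField.pow_card]
  have hσL : ∀ x, φ k (L x) = L (φ k x) := fun x => by
    rw [hL, hL, map_add, map_sum]
    simp only [hcomm k]
  have htwo : ∀ x : F, x + x = 0 := CharTwo.add_self_eq_zero
  have hL1 : L 1 = 1 := by
    have hne : (ρ : F) + 1 ≠ 0 := fun h => one_ne_zero (h2 1 (one_pow _) (by simpa using h))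
    have hv : L 1 = 1 + (ρ : F) := by simp [hL]
    rcases Nat.even_or_odd' ρ with ⟨m, rfl | rfl⟩
    · rw [hv]; push_cast; linear_combination htwo (m : F)
    · refine absurd ?_ hne
      rw [Nat.cast_add, Nat.cast_mul]
      push_cast
      linear_combination htwo (m : F) + htwo 1
  have hD : ∀ x, G x + G (x + a) = φ i a * L (x + φ k x) + φ i x + φ i a := fun x => by
    have hG : ∀ y, G y = φ i y * L (y + φ k y) := fun y => by rw [hGdef, hL', hφ, hφ]
    have ha' : a + φ k a = 1 := by rw [hφ, ha]
    rw [hG, hG, map_add (φ k), add_add_add_comm, ha', map_add L _ 1, hL1, map_add (φ i)]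
    linear_combination htwo (φ i x * L (x + φ k x))
  by_cases hb : ∃ x₀, G x₀ + G (x₀ + a) = b
  · obtain ⟨x₀, rfl⟩ := hb
    have hcard := card_fiber_eq_card_fixed (φ k) (φ i) L hσ (hcomm k i) hσL
      (a := a) (by rw [hφ, ha]) x₀
    simp only [hD, add_left_inj]
    rw [hcard]
    refine fun h => hsol (h ▸ Nat.card_congr (Equiv.subtypeEquivRight fun z => ?_))
    rw [hφ, hφ, hL', add_assoc, CharTwo.add_eq_zero]
  · have : IsEmpty {x // G x + G (x + a) = b} := ⟨fun x => hb ⟨x.1, x.2⟩⟩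
    rw [Nat.card_of_isEmpty]
    positivity
end
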